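/- Let f : ℝ^d → ℝ be differentiable with L_f-Lipschitz gradient and let r₁, r₂ : ℝ^d → ℝ be convex. Assume there exist μ > 0 and R₀ ≥ 0 such that for all x, y with ‖x − y‖ ≥ R₀ and all subgradients u₁ of r₁ at x, u₂ of r₂ at x, v₁ of r₁ at y, v₂ of r₂ at y: ⟨∇f(x) + u₁ − u₂ − ∇f(y) − v₁ + v₂, x − y⟩ ≥ μ‖x − y‖². Set V = f + r₁ − r₂. Then there exists D ≥ 0 such that V(x) − V(0) ≥ (μ/4)‖x‖² − D for all x ∈ ℝ^d; in particular the density x ↦ exp(−V(x)) has sub-Gaussian tails. -/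

import Mathlib

open scoped RealInnerProductSpace

/-- `u` is a subgradient of `g` at `x`. -/
def IsSubgradAt {d : ℕ} (g : EuclideanSpace ℝ (Fin d) → ℝ)
    (x u : EuclideanSpace ℝ (Fin d)) : Prop :=
  ∀ y, g x + ⟪u, y - x⟫ ≤ g y

/-- A real-valued convex function on Euclidean space has a subgradient at every point. -/
theorem ConvexOn.exists_isSubgradAt {d : ℕ} {g : EuclideanSpace ℝ (Fin d) → ℝ}
    (hg : ConvexOn ℝ Set.univ g) (x : EuclideanSpace ℝ (Fin d)) :
    ∃ u, IsSubgradAt g x u := by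
  have hc : Continuous g := continuousOn_univ.1 (hg.continuousOn isOpen_univ)
  have hconv : Convex ℝ {p : EuclideanSpace ℝ (Fin d) × ℝ | g p.1 < p.2} := by
    simpa using hg.convex_strict_epigraph
  have hopen : IsOpen {p : EuclideanSpace ℝ (Fin d) × ℝ | g p.1 < p.2} :=
    isOpen_lt (hc.comp continuous_fst) continuous_snd
  obtain ⟨L, hL⟩ := geometric_hahn_banach_point_open hconv hopen
    (x := (x, g x)) (by simp)
  set ℓ := L.comp (ContinuousLinearMap.inl ℝ (EuclideanSpace ℝ (Fin d)) ℝ)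
  set β := L (0, 1)
  have hsplit (y : EuclideanSpace ℝ (Fin d)) (c : ℝ) : L (y, c) = ℓ y + c * β := by
    have h : ((y, c) : EuclideanSpace ℝ (Fin d) × ℝ) = (y, 0) + c • (0, 1) := by simp
    rw [h, map_add, map_smul]
    rfl
  have hlt (y : EuclideanSpace ℝ (Fin d)) (c : ℝ) (hy : g y < c) :
      ℓ x + g x * β < ℓ y + c * β := by
    rw [← hsplit, ← hsplit]
    exact hL (y, c) hy
  have hβ0 : 0 < β := by
    have := hlt x (g x + 1) (by linarith)
    linarith
  refine ⟨-(β⁻¹ • (InnerProductSpace.toDual ℝ _).symm ℓ), fun y => ?_⟩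
  rw [inner_neg_left, real_inner_smul_left, InnerProductSpace.toDual_symm_apply, map_sub]
  refine le_of_forall_gt_imp_ge_of_dense fun c hy => ?_
  have := hlt y c hy
  have h : β * (g x + -(β⁻¹ * (ℓ y - ℓ x))) ≤ β * c := by
    rw [mul_add, mul_neg, mul_inv_cancel_left₀ hβ0.ne']
    linarith
  exact le_of_mul_le_mul_left h hβ0

/-- A function whose increments are bounded below by a quadratic term and a telescoping
first-order term is monotone. -/
theorem le_of_forall_quadratic_telescoping_lower_bound {w s : ℝ → ℝ} {A C : ℝ}
    (h : ∀ a b, A ≤ a → a ≤ b →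
      -(C * (b - a) ^ 2) - (b - a) * (s b - s a) ≤ w b - w a)
    {a b : ℝ} (ha : A ≤ a) (hab : a ≤ b) : w a ≤ w b := by
  have hsum (δ : ℝ) (hδ : 0 ≤ δ) (k : ℕ) :
      -(k * (C * δ ^ 2)) - δ * (s (a + k * δ) - s a) ≤ w (a + k * δ) - w a := by
    induction k with
    | zero => simp
    | succ k ih =>
      have hk : 0 ≤ (k : ℝ) * δ := by positivity
      have := h (a + k * δ) (a + (k + 1 : ℕ) * δ) (by linarith) (by push_cast; linarith)
      have e : a + (k + 1 : ℕ) * δ - (a + k * δ) = δ := by push_cast; ring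
      rw [e] at this
      push_cast at this ⊢
      linarith
  by_contra! hlt
  obtain ⟨n, hn⟩ := exists_nat_gt ((C * (b - a) ^ 2 + (b - a) * (s b - s a)) / (w a - w b))
  have hgap : 0 < w a - w b := sub_pos.2 hlt
  have hn1 : (0 : ℝ) < (n + 1 : ℕ) := by positivity
  have := hsum ((b - a) / (n + 1 : ℕ)) (div_nonneg (sub_nonneg.2 hab) hn1.le) (n + 1)
  rw [mul_div_cancel₀ _ hn1.ne', add_sub_cancel] at this
  rw [div_lt_iff₀ hgap] at hn
  have key := mul_le_mul_of_nonneg_left this hn1.le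
  have e : ((n + 1 : ℕ) : ℝ) * (-((n + 1 : ℕ) * (C * ((b - a) / (n + 1 : ℕ)) ^ 2)) -
      (b - a) / (n + 1 : ℕ) * (s b - s a)) = -(C * (b - a) ^ 2) - (b - a) * (s b - s a) := by
    field_simp
  rw [e] at key
  push_cast at key
  linarith

/-- A first-order lower bound for a function with Lipschitz gradient. -/
theorem HasGradientAt.sub_ge_of_lipschitz {E : Type*} [NormedAddCommGroup E]
    [InnerProductSpace ℝ E] [CompleteSpace E] {f : E → ℝ} {f' : E → E} {L : ℝ}
    (hf : ∀ x, HasGradientAt f (f' x) x) (hL : ∀ x y, ‖f' x - f' y‖ ≤ L * ‖x - y‖) (x y : E) :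
    ⟪f' x, y - x⟫ - |L| * ‖y - x‖ ^ 2 ≤ f y - f x := by
  have h := (convex_segment x y).norm_image_sub_le_of_norm_hasFDerivWithin_le'
    (f := f) (φ := InnerProductSpace.toDual ℝ E (f' x)) (C := |L| * ‖y - x‖)
    (fun z _ => (hf z).hasFDerivAt.hasFDerivWithinAt) (fun z hz => by
      rw [← map_sub, LinearIsometryEquiv.norm_map]
      calc ‖f' z - f' x‖ ≤ L * ‖z - x‖ := hL z x
        _ ≤ |L| * ‖z - x‖ := by gcongr; exact le_abs_self L
        _ ≤ |L| * ‖y - x‖ := by gcongr; exact norm_sub_le_of_mem_segment hz)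
    (left_mem_segment ℝ x y) (right_mem_segment ℝ x y)
  rw [InnerProductSpace.toDual_apply_apply, Real.norm_eq_abs] at h
  have := (abs_le.1 h).1
  linarith

/-- Under distant dissipativity of the generalized gradient of
`V = f + r₁ − r₂`, the potential `V` has quadratic growth:
`V(x) − V(0) ≥ (μ/4)‖x‖² − D` for some `D ≥ 0`; hence `exp(−V)` has sub-Gaussian tails. -/
theorem potential_quadratic_growth {d : ℕ}
    (f r1 r2 : EuclideanSpace ℝ (Fin d) → ℝ)
    (f' : EuclideanSpace ℝ (Fin d) → EuclideanSpace ℝ (Fin d))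
    (Lf mu R0 : ℝ)
    (hf : ∀ x, HasGradientAt f (f' x) x)
    (hLf : ∀ x y, ‖f' x - f' y‖ ≤ Lf * ‖x - y‖)
    (hr1 : ConvexOn ℝ Set.univ r1) (hr2 : ConvexOn ℝ Set.univ r2)
    (hmu : 0 < mu) (hR0 : 0 ≤ R0)
    (hdiss : ∀ x y u1 u2 v1 v2, R0 ≤ ‖x - y‖ →
      IsSubgradAt r1 x u1 → IsSubgradAt r2 x u2 →
      IsSubgradAt r1 y v1 → IsSubgradAt r2 y v2 →
      mu * ‖x - y‖ ^ 2 ≤ ⟪f' x + u1 - u2 - f' y - v1 + v2, x - y⟫) :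
    ∃ D : ℝ, 0 ≤ D ∧ ∀ x : EuclideanSpace ℝ (Fin d),
      (mu / 4) * ‖x‖ ^ 2 - D ≤
        (f x + r1 x - r2 x) - (f 0 + r1 0 - r2 0) := by
  choose p1 hp1 using hr1.exists_isSubgradAt
  choose p2 hp2 using hr2.exists_isSubgradAt
  have hfc : Continuous f := continuous_iff_continuousAt.2 fun x => (hf x).continuousAt
  have hr1c : Continuous r1 := continuousOn_univ.1 (hr1.continuousOn isOpen_univ)
  have hr2c : Continuous r2 := continuousOn_univ.1 (hr2.continuousOn isOpen_univ)
  set V := fun x => f x + r1 x - r2 x with hV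
  have hVc : Continuous V := (hfc.add hr1c).sub hr2c
  set A := R0 + 1 with hA
  have hA0 : 0 < A := by linarith
  set G := ‖f' 0 + p1 0 - p2 0‖
  have hG0 : 0 ≤ G := norm_nonneg _
  obtain ⟨x₀, -, hx₀⟩ := (isCompact_closedBall (0 : EuclideanSpace ℝ (Fin d)) A).exists_isMinOn
    ⟨0, by simp [hA0.le]⟩ hVc.continuousOn
  have hmin (x : EuclideanSpace ℝ (Fin d)) (hx : ‖x‖ ≤ A) : V x₀ ≤ V x :=
    hx₀ (by simpa using hx)
  have hray (e : EuclideanSpace ℝ (Fin d)) (he : ‖e‖ = 1) (t : ℝ) (ht : A ≤ t) :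
      V (A • e) - mu / 2 * A ^ 2 + G * A ≤ V (t • e) - mu / 2 * t ^ 2 + G * t := by
    refine le_of_forall_quadratic_telescoping_lower_bound
      (w := fun t => V (t • e) - mu / 2 * t ^ 2 + G * t) (s := fun t => ⟪p2 (t • e), e⟫)
      (A := A) (C := |Lf| + mu / 2) (fun a b ha hab => ?_) le_rfl ht
    have ha0 : 0 < a := hA0.trans_le ha
    have hsub : b • e - a • e = (b - a) • e := (sub_smul b a e).symm
    have hnorm : ‖(b - a) • e‖ = b - a := by
      rw [norm_smul, he, mul_one, Real.norm_of_nonneg (sub_nonneg.2 hab)]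
    have h1 := HasGradientAt.sub_ge_of_lipschitz hf hLf (a • e) (b • e)
    rw [hsub, hnorm, real_inner_smul_right] at h1
    have h2 := hp1 (a • e) (b • e)
    rw [hsub, real_inner_smul_right] at h2
    have h3 := hp2 (b • e) (a • e)
    rw [← neg_sub, hsub, inner_neg_right, real_inner_smul_right] at h3
    have hna : ‖a • e - 0‖ = a := by
      rw [sub_zero, norm_smul, he, mul_one, Real.norm_of_nonneg ha0.le]
    have h4 := hdiss (a • e) 0 _ _ _ _ (by rw [hna]; linarith) (hp1 _) (hp2 _) (hp1 0) (hp2 0)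
    rw [hna, sub_zero, real_inner_smul_right, sq, mul_left_comm] at h4
    have h5 := le_of_mul_le_mul_left h4 ha0
    have h6 : -G ≤ ⟪f' 0 + p1 0 - p2 0, e⟫ := by
      have := (abs_le.1 (abs_real_inner_le_norm (f' 0 + p1 0 - p2 0) e)).1
      rwa [he, mul_one] at this
    simp only [inner_add_left, inner_sub_left] at h5 h6
    have h7 : mu * a - G + ⟪p2 (a • e), e⟫ ≤ ⟪f' (a • e), e⟫ + ⟪p1 (a • e), e⟫ := by linarith
    have h8 := mul_le_mul_of_nonneg_left h7 (sub_nonneg.2 hab)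
    simp only [hV]
    linarith
  refine ⟨|V x₀ - V 0| + mu / 2 * A ^ 2 + G ^ 2 / mu, by positivity, fun x => ?_⟩
  change _ ≤ V x - V 0
  have habs := neg_abs_le (V x₀ - V 0)
  have hGmu : 0 ≤ G ^ 2 / mu := by positivity
  rcases le_total ‖x‖ A with hx | hx
  · have h1 := hmin x hx
    have h2 : ‖x‖ ^ 2 ≤ A ^ 2 := by gcongr
    nlinarith
  · have hx0 : 0 < ‖x‖ := hA0.trans_le hx
    have he : ‖‖x‖⁻¹ • x‖ = 1 := by
      rw [norm_smul, norm_inv, norm_norm, inv_mul_cancel₀ hx0.ne']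
    have h1 := hray (‖x‖⁻¹ • x) he ‖x‖ hx
    rw [smul_inv_smul₀ hx0.ne'] at h1
    have h2 := hmin (A • ‖x‖⁻¹ • x) (by
      rw [norm_smul, he, mul_one, Real.norm_of_nonneg hA0.le])
    have h3 : 0 ≤ mu / 4 * ‖x‖ ^ 2 - G * ‖x‖ + G ^ 2 / mu := by
      have : mu / 4 * ‖x‖ ^ 2 - G * ‖x‖ + G ^ 2 / mu = (mu / 2 * ‖x‖ - G) ^ 2 / mu := by
        field_simp
        ring
      rw [this]
      positivity
    have h4 : 0 ≤ G * A := by positivity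
    linarith
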